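/- Let m, n be positive integers, let Ψ₁, ..., Ψₘ be nonempty bounded sets of n×n matrices with nonnegative real entries, and let α₁, ..., αₘ be positive real numbers with α₁ + ⋯ + αₘ = 1. Then ρ̂(Ψ₁^(α₁) ∘ ⋯ ∘ Ψₘ^(αₘ)) ≤ ρ̂(Ψ₁)^{α₁} ⋯ ρ̂(Ψₘ)^{αₘ}, where ρ̂ denotes the joint spectral radius of a set. -/

import Mathlib

open scoped ENNReal NNReal BigOperators

/-- Spectral radius of a real matrix: the spectral radius of the corresponding
complex matrix (equivalently, the maximum modulus of its complex eigenvalues). -/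
noncomputable def specRad {n : ℕ} (A : Matrix (Fin n) (Fin n) ℝ) : ℝ≥0∞ :=
  spectralRadius ℂ (A.map (fun x => (x : ℂ)))

/-- Operator norm of a real `n × n` matrix induced by the Euclidean norm on `ℝⁿ`. -/
noncomputable def opNorm {n : ℕ} (A : Matrix (Fin n) (Fin n) ℝ) : ℝ :=
  ‖LinearMap.toContinuousLinearMap (Matrix.toEuclideanLin A)‖

/-- The weighted Hadamard (Schur) geometric mean `A₁^(α₁) ∘ ⋯ ∘ Aₘ^(αₘ)`. -/
noncomputable def hadWMean {n m : ℕ} (α : Fin m → ℝ)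
    (A : Fin m → Matrix (Fin n) (Fin n) ℝ) : Matrix (Fin n) (Fin n) ℝ :=
  Matrix.of fun x y => ∏ j, (A j x y) ^ (α j)

/-- The ordered product `A 0 * A 1 * ⋯ * A (k-1)`. -/
def matListProd {n k : ℕ} (A : Fin k → Matrix (Fin n) (Fin n) ℝ) :
    Matrix (Fin n) (Fin n) ℝ :=
  (List.ofFn A).prod

/-- The set `Σ^k` of all products of `k` elements of `S`. -/
def setPow {n : ℕ} (S : Set (Matrix (Fin n) (Fin n) ℝ)) (k : ℕ) :
    Set (Matrix (Fin n) (Fin n) ℝ) :=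
  {B | ∃ A : Fin k → Matrix (Fin n) (Fin n) ℝ, (∀ i, A i ∈ S) ∧ B = matListProd A}

/-- The set `Ψ₁ Ψ₂ ⋯ Ψₘ` of products with the `j`-th factor from `Ψ j`. -/
def setProd {n m : ℕ} (Ψ : Fin m → Set (Matrix (Fin n) (Fin n) ℝ)) :
    Set (Matrix (Fin n) (Fin n) ℝ) :=
  {B | ∃ A : Fin m → Matrix (Fin n) (Fin n) ℝ, (∀ j, A j ∈ Ψ j) ∧ B = matListProd A}

/-- The weighted Hadamard geometric mean `Ψ₁^(α₁) ∘ ⋯ ∘ Ψₘ^(αₘ)` of sets. -/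
noncomputable def setHadWMean {n m : ℕ} (α : Fin m → ℝ)
    (Ψ : Fin m → Set (Matrix (Fin n) (Fin n) ℝ)) :
    Set (Matrix (Fin n) (Fin n) ℝ) :=
  {B | ∃ A : Fin m → Matrix (Fin n) (Fin n) ℝ, (∀ j, A j ∈ Ψ j) ∧ B = hadWMean α A}

/-- The generalized spectral radius `ρ(Σ) = limsup_{k→∞} (sup_{A ∈ Σ^k} ρ(A))^{1/k}`. -/
noncomputable def genSpecRad {n : ℕ} (S : Set (Matrix (Fin n) (Fin n) ℝ)) : ℝ≥0∞ :=
  Filter.atTop.limsup fun k : ℕ => (⨆ B ∈ setPow S k, specRad B) ^ (1 / (k : ℝ))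

/-- The joint spectral radius `ρ̂(Σ) = limsup_{k→∞} (sup_{A ∈ Σ^k} ‖A‖)^{1/k}`. -/
noncomputable def jointSpecRad {n : ℕ} (S : Set (Matrix (Fin n) (Fin n) ℝ)) : ℝ≥0∞ :=
  Filter.atTop.limsup fun k : ℕ =>
    (⨆ B ∈ setPow S k, ENNReal.ofReal (opNorm B)) ^ (1 / (k : ℝ))

open Filter

/-- Hölder's inequality for finite sums and a finite family of weights of total mass one. -/
theorem Real.sum_prod_rpow_le_prod_sum_rpow {ι κ : Type*} [Fintype ι] [Fintype κ]
    {f : κ → ι → ℝ} (hf : ∀ j i, 0 ≤ f j i) {α : κ → ℝ} (hα : ∀ j, 0 ≤ α j)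
    (hsum : ∑ j, α j = 1) :
    ∑ i, ∏ j, f j i ^ α j ≤ ∏ j, (∑ i, f j i) ^ α j := by
  let _ : MeasurableSpace ι := ⊤
  have h := ENNReal.lintegral_prod_norm_pow_le (μ := MeasureTheory.Measure.count) Finset.univ
    (f := fun j i => ENNReal.ofReal (f j i))
    (fun j _ => (measurable_of_finite _).aemeasurable) hsum (fun j _ => hα j)
  simp only [MeasureTheory.lintegral_count, tsum_fintype] at h
  have hs : ∀ j, 0 ≤ ∑ i, f j i := fun j => Finset.sum_nonneg fun i _ => hf j i
  have hl : ∀ i, ∏ j, ENNReal.ofReal (f j i) ^ α j = ENNReal.ofReal (∏ j, f j i ^ α j) := by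
    intro i
    rw [ENNReal.ofReal_prod_of_nonneg fun j _ => Real.rpow_nonneg (hf j i) _]
    exact Finset.prod_congr rfl fun j _ => ENNReal.ofReal_rpow_of_nonneg (hf j i) (hα j)
  have hr : ∏ j, (∑ i, ENNReal.ofReal (f j i)) ^ α j
      = ENNReal.ofReal (∏ j, (∑ i, f j i) ^ α j) := by
    rw [ENNReal.ofReal_prod_of_nonneg fun j _ => Real.rpow_nonneg (hs j) _]
    refine Finset.prod_congr rfl fun j _ => ?_
    rw [← ENNReal.ofReal_sum_of_nonneg fun i _ => hf j i,
      ENNReal.ofReal_rpow_of_nonneg (hs j) (hα j)]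
  simp only [hl] at h
  rw [hr, ← ENNReal.ofReal_sum_of_nonneg
    fun i _ => Finset.prod_nonneg fun j _ => Real.rpow_nonneg (hf j i) _] at h
  exact (ENNReal.ofReal_le_ofReal_iff
    (Finset.prod_nonneg fun j _ => Real.rpow_nonneg (hs j) _)).1 h

theorem Real.prod_mul_const_rpow {κ : Type*} [Fintype κ] {a : κ → ℝ} (ha : ∀ j, 0 ≤ a j)
    {c : ℝ} (hc : 0 ≤ c) {α : κ → ℝ} (hα : ∀ j, 0 ≤ α j) (hsum : ∑ j, α j = 1) :
    ∏ j, (a j * c) ^ α j = (∏ j, a j ^ α j) * c := by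
  simp_rw [Real.mul_rpow (ha _) hc]
  rw [Finset.prod_mul_distrib, ← Real.rpow_sum_of_nonneg hc fun j _ => hα j, hsum,
    Real.rpow_one]

theorem opNorm_nonneg {n : ℕ} (A : Matrix (Fin n) (Fin n) ℝ) : 0 ≤ opNorm A :=
  norm_nonneg _

theorem norm_toEuclideanLin_le {n : ℕ} (A : Matrix (Fin n) (Fin n) ℝ)
    (v : EuclideanSpace ℝ (Fin n)) : ‖Matrix.toEuclideanLin A v‖ ≤ opNorm A * ‖v‖ :=
  (LinearMap.toContinuousLinearMap (Matrix.toEuclideanLin A)).le_opNorm v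

theorem opNorm_one_le {n : ℕ} : opNorm (1 : Matrix (Fin n) (Fin n) ℝ) ≤ 1 :=
  ContinuousLinearMap.opNorm_le_bound _ zero_le_one fun v => by
    simp

theorem opNorm_mul_le {n : ℕ} (A B : Matrix (Fin n) (Fin n) ℝ) :
    opNorm (A * B) ≤ opNorm A * opNorm B := by
  refine ContinuousLinearMap.opNorm_le_bound _
    (mul_nonneg (opNorm_nonneg A) (opNorm_nonneg B)) fun v => ?_
  have h : Matrix.toEuclideanLin (A * B) v
      = Matrix.toEuclideanLin A (Matrix.toEuclideanLin B v) := by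
    simp [Matrix.toLpLin_apply, Matrix.mulVec_mulVec]
  calc ‖Matrix.toEuclideanLin (A * B) v‖
      ≤ opNorm A * ‖Matrix.toEuclideanLin B v‖ := h ▸ norm_toEuclideanLin_le A _
    _ ≤ opNorm A * (opNorm B * ‖v‖) :=
        mul_le_mul_of_nonneg_left (norm_toEuclideanLin_le B v) (opNorm_nonneg A)
    _ = opNorm A * opNorm B * ‖v‖ := (mul_assoc _ _ _).symm

theorem matListProd_succ {n k : ℕ} (A : Fin (k + 1) → Matrix (Fin n) (Fin n) ℝ) :
    matListProd A = A 0 * matListProd fun i => A i.succ := by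
  simp [matListProd, List.ofFn_succ]

theorem opNorm_matListProd_le {n k : ℕ} {A : Fin k → Matrix (Fin n) (Fin n) ℝ} {C : ℝ}
    (hC : 0 ≤ C) (hA : ∀ i, opNorm (A i) ≤ C) : opNorm (matListProd A) ≤ C ^ k := by
  induction k with
  | zero => simpa [matListProd] using opNorm_one_le
  | succ k ih =>
    rw [matListProd_succ, pow_succ']
    exact (opNorm_mul_le _ _).trans
      (mul_le_mul (hA 0) (ih fun i => hA i.succ) (opNorm_nonneg _) hC)

theorem matListProd_nonneg {n k : ℕ} {A : Fin k → Matrix (Fin n) (Fin n) ℝ}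
    (hA : ∀ i x y, 0 ≤ A i x y) (x y : Fin n) : 0 ≤ matListProd A x y := by
  induction k generalizing x y with
  | zero =>
    simp only [matListProd, List.ofFn_zero, List.prod_nil, Matrix.one_apply]
    split_ifs <;> norm_num
  | succ k ih =>
    rw [matListProd_succ, Matrix.mul_apply]
    exact Finset.sum_nonneg fun z _ => mul_nonneg (hA 0 x z) (ih (fun i => hA i.succ) z y)

theorem hadWMean_nonneg {n m : ℕ} (α : Fin m → ℝ) {A : Fin m → Matrix (Fin n) (Fin n) ℝ}
    (hA : ∀ j x y, 0 ≤ A j x y) (x y : Fin n) : 0 ≤ hadWMean α A x y := by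
  rw [hadWMean, Matrix.of_apply]
  exact Finset.prod_nonneg fun j _ => Real.rpow_nonneg (hA j x y) _

theorem hadWMean_mul_hadWMean_le {n m : ℕ} {α : Fin m → ℝ} (hα : ∀ j, 0 ≤ α j)
    (hsum : ∑ j, α j = 1) {A B : Fin m → Matrix (Fin n) (Fin n) ℝ}
    (hA : ∀ j x y, 0 ≤ A j x y) (hB : ∀ j x y, 0 ≤ B j x y) (x y : Fin n) :
    (hadWMean α A * hadWMean α B) x y ≤ hadWMean α (fun j => A j * B j) x y := by
  simp only [hadWMean, Matrix.mul_apply, Matrix.of_apply, ← Finset.prod_mul_distrib]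
  refine le_trans (le_of_eq ?_) (Real.sum_prod_rpow_le_prod_sum_rpow
    (f := fun j z => A j x z * B j z y) (fun j z => mul_nonneg (hA j x z) (hB j z y)) hα hsum)
  exact Finset.sum_congr rfl fun z _ => Finset.prod_congr rfl fun j _ =>
    (Real.mul_rpow (hA j x z) (hB j z y)).symm

theorem matListProd_hadWMean_le {n m k : ℕ} {α : Fin m → ℝ} (hα : ∀ j, 0 ≤ α j)
    (hsum : ∑ j, α j = 1) {A : Fin k → Fin m → Matrix (Fin n) (Fin n) ℝ}
    (hA : ∀ i j x y, 0 ≤ A i j x y) (x y : Fin n) :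
    matListProd (fun i => hadWMean α (A i)) x y
      ≤ hadWMean α (fun j => matListProd fun i => A i j) x y := by
  induction k generalizing x y with
  | zero =>
    by_cases hxy : x = y
    · simp [matListProd, hadWMean, hxy]
    · simpa [matListProd, Matrix.one_apply, hxy] using
        hadWMean_nonneg α (fun j => matListProd_nonneg fun i => hA i j) x y
  | succ k ih =>
    simp only [matListProd_succ]
    refine le_trans ?_ (hadWMean_mul_hadWMean_le hα hsum (hA 0)
      (fun j => matListProd_nonneg fun i => hA i.succ j) x y)
    rw [Matrix.mul_apply, Matrix.mul_apply]
    exact Finset.sum_le_sum fun z _ => mul_le_mul_of_nonneg_left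
      (ih (fun i => hA i.succ) z y) (hadWMean_nonneg α (hA 0) x z)

/-- The operator norm of a matrix dominated entrywise by a weighted Hadamard geometric mean of
nonnegative matrices is at most the weighted geometric mean of their operator norms. -/
theorem opNorm_le_prod_opNorm_rpow {n m : ℕ} {α : Fin m → ℝ} (hα : ∀ j, 0 ≤ α j)
    (hsum : ∑ j, α j = 1) {B : Fin m → Matrix (Fin n) (Fin n) ℝ}
    (hB : ∀ j x y, 0 ≤ B j x y) {M : Matrix (Fin n) (Fin n) ℝ}
    (hM : ∀ x y, |M x y| ≤ hadWMean α B x y) :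
    opNorm M ≤ ∏ j, opNorm (B j) ^ α j := by
  refine ContinuousLinearMap.opNorm_le_bound _
    (Finset.prod_nonneg fun j _ => Real.rpow_nonneg (opNorm_nonneg _) _) fun v => ?_
  set w : EuclideanSpace ℝ (Fin n) := WithLp.toLp 2 fun y => |v y| with hw
  have hwv : ‖w‖ = ‖v‖ := by simp [EuclideanSpace.norm_eq, hw]
  have hBw : ∀ j x, Matrix.toEuclideanLin (B j) w x = ∑ y, B j x y * |v y| := fun j x => by
    simp [Matrix.toLpLin_apply, Matrix.mulVec, dotProduct, hw]
  have hBw0 : ∀ j x, 0 ≤ Matrix.toEuclideanLin (B j) w x := fun j x => by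
    rw [hBw]
    exact Finset.sum_nonneg fun y _ => mul_nonneg (hB j x y) (abs_nonneg _)
  have hent : ∀ x, |Matrix.toEuclideanLin M v x|
      ≤ ∏ j, (Matrix.toEuclideanLin (B j) w x) ^ α j := fun x => by
    have hMv : Matrix.toEuclideanLin M v x = ∑ y, M x y * v y := by
      simp [Matrix.toLpLin_apply, Matrix.mulVec, dotProduct]
    simp only [hBw]
    rw [hMv]
    calc |∑ y, M x y * v y| ≤ ∑ y, |M x y| * |v y| := by
          simpa only [abs_mul] using Finset.abs_sum_le_sum_abs (fun y => M x y * v y) Finset.univ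
      _ ≤ ∑ y, (∏ j, B j x y ^ α j) * |v y| :=
          Finset.sum_le_sum fun y _ => mul_le_mul_of_nonneg_right (hM x y) (abs_nonneg _)
      _ = ∑ y, ∏ j, (B j x y * |v y|) ^ α j := by
          refine Finset.sum_congr rfl fun y _ => ?_
          rw [Real.prod_mul_const_rpow (fun j => hB j x y) (abs_nonneg _) hα hsum]
      _ ≤ _ := Real.sum_prod_rpow_le_prod_sum_rpow
          (fun j y => mul_nonneg (hB j x y) (abs_nonneg _)) hα hsum
  have hsq : ∀ a : Fin m → ℝ, (∀ j, 0 ≤ a j) →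
      (∏ j, a j ^ α j) ^ 2 = ∏ j, (a j ^ 2) ^ α j := fun a ha => by
    rw [← Finset.prod_pow]
    exact Finset.prod_congr rfl fun j _ => Real.rpow_pow_comm (ha j) _ _
  have hnorm : ‖Matrix.toEuclideanLin M v‖ ≤ ∏ j, ‖Matrix.toEuclideanLin (B j) w‖ ^ α j := by
    refine le_of_sq_le_sq ?_
      (Finset.prod_nonneg fun j _ => Real.rpow_nonneg (norm_nonneg _) _)
    rw [hsq _ fun j => norm_nonneg _]
    simp only [EuclideanSpace.norm_sq_eq, Real.norm_eq_abs, sq_abs]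
    refine le_trans (Finset.sum_le_sum fun x _ => ?_)
      (Real.sum_prod_rpow_le_prod_sum_rpow (fun j x => sq_nonneg _) hα hsum)
    rw [← hsq _ fun j => hBw0 j x, ← sq_abs]
    exact pow_le_pow_left₀ (abs_nonneg _) (hent x) 2
  refine hnorm.trans ?_
  rw [← Real.prod_mul_const_rpow (fun j => opNorm_nonneg (B j)) (norm_nonneg v) hα hsum]
  refine Finset.prod_le_prod (fun j _ => Real.rpow_nonneg (norm_nonneg _) _) fun j _ =>
    Real.rpow_le_rpow (norm_nonneg _) ?_ (hα j)
  simpa [hwv] using norm_toEuclideanLin_le (B j) w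

theorem iSup_setPow_rpow_le {n : ℕ} {S : Set (Matrix (Fin n) (Fin n) ℝ)} {C : ℝ}
    (hC : 0 ≤ C) (hS : ∀ B ∈ S, opNorm B ≤ C) {k : ℕ} (hk : k ≠ 0) :
    (⨆ B ∈ setPow S k, ENNReal.ofReal (opNorm B)) ^ (1 / (k : ℝ)) ≤ ENNReal.ofReal C := by
  rw [one_div, ENNReal.rpow_inv_le_iff (by positivity), ENNReal.rpow_natCast,
    ← ENNReal.ofReal_pow hC]
  refine iSup₂_le fun B hB => ENNReal.ofReal_le_ofReal ?_
  obtain ⟨A, hA, rfl⟩ := hB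
  exact opNorm_matListProd_le hC fun i => hS _ (hA i)

theorem jointSpecRad_ne_top {n : ℕ} {S : Set (Matrix (Fin n) (Fin n) ℝ)} {C : ℝ}
    (hS : ∀ B ∈ S, opNorm B ≤ C) : jointSpecRad S ≠ ∞ := by
  refine ne_top_of_le_ne_top (ENNReal.ofReal_ne_top (r := max C 0)) (limsup_le_of_le ?_ ?_)
  · isBoundedDefault
  · filter_upwards [eventually_ne_atTop 0] with k hk
    exact iSup_setPow_rpow_le (le_max_right C 0) (fun B hB => (hS B hB).trans (le_max_left C 0)) hk

theorem iSup_setPow_setHadWMean_le {n m : ℕ} {Ψ : Fin m → Set (Matrix (Fin n) (Fin n) ℝ)}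
    (hpos : ∀ j, ∀ B ∈ Ψ j, ∀ x y, 0 ≤ B x y) {α : Fin m → ℝ} (hα : ∀ j, 0 ≤ α j)
    (hsum : ∑ j, α j = 1) (k : ℕ) :
    ⨆ B ∈ setPow (setHadWMean α Ψ) k, ENNReal.ofReal (opNorm B)
      ≤ ∏ j, (⨆ B ∈ setPow (Ψ j) k, ENNReal.ofReal (opNorm B)) ^ α j := by
  refine iSup₂_le fun M hM => ?_
  obtain ⟨H, hH, rfl⟩ := hM
  choose A hA hHA using hH
  obtain rfl : H = fun i => hadWMean α (A i) := funext hHA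
  have hA0 : ∀ i j x y, 0 ≤ A i j x y := fun i j => hpos j _ (hA i j)
  have h := opNorm_le_prod_opNorm_rpow hα hsum (M := matListProd fun i => hadWMean α (A i))
    (fun j => matListProd_nonneg fun i => hA0 i j) fun x y => by
      rw [abs_of_nonneg (matListProd_nonneg (fun i => hadWMean_nonneg α (hA0 i)) x y)]
      exact matListProd_hadWMean_le hα hsum hA0 x y
  refine (ENNReal.ofReal_le_ofReal h).trans ?_
  rw [ENNReal.ofReal_prod_of_nonneg fun j _ => Real.rpow_nonneg (opNorm_nonneg _) _]
  refine Finset.prod_le_prod' fun j _ => ?_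
  rw [← ENNReal.ofReal_rpow_of_nonneg (opNorm_nonneg _) (hα j)]
  exact ENNReal.rpow_le_rpow
    (le_iSup₂_of_le (matListProd fun i => A i j) ⟨fun i => A i j, fun i => hA i j, rfl⟩ le_rfl)
    (hα j)

theorem ENNReal.limsup_rpow {ι : Type*} {f : Filter ι} (u : ι → ℝ≥0∞) {a : ℝ} (ha : 0 < a) :
    limsup (fun i => u i ^ a) f = limsup u f ^ a :=
  ((ENNReal.orderIsoRpow a ha).limsup_apply (f := f) (u := u)).symm

theorem ENNReal.limsup_finset_prod_le {ι κ : Type*} {f : Filter ι} (s : Finset κ)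
    {u : κ → ι → ℝ≥0∞} (hu : ∀ j ∈ s, limsup (u j) f ≠ ∞) :
    limsup (fun i => ∏ j ∈ s, u j i) f ≤ ∏ j ∈ s, limsup (u j) f := by
  classical
  induction s using Finset.induction with
  | empty =>
    simp only [Finset.prod_empty]
    exact limsup_le_of_le (by isBoundedDefault) (Eventually.of_forall fun _ => le_rfl)
  | insert a s ha ih =>
    simp only [Finset.prod_insert ha]
    have hs := ih fun j hj => hu j (Finset.mem_insert_of_mem hj)
    have hfin : limsup (fun i => ∏ j ∈ s, u j i) f ≠ ∞ := ne_top_of_le_ne_top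
      (ENNReal.prod_ne_top fun j hj => hu j (Finset.mem_insert_of_mem hj)) hs
    exact (ENNReal.limsup_mul_le' (Or.inr hfin)
      (Or.inl (hu a (Finset.mem_insert_self a s)))).trans (mul_le_mul_right hs _)

/-- Theorem 3.3, inequality (11), for bounded sets of non-negative matrices:
`ρ̂(Ψ₁^(α₁) ∘ ⋯ ∘ Ψₘ^(αₘ)) ≤ ρ̂(Ψ₁)^(α₁) ⋯ ρ̂(Ψₘ)^(αₘ)` for the joint
spectral radius. -/
theorem jointSpecRad_setHadWMean_le {m n : ℕ} (hm : 0 < m) (hn : 0 < n)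
    (Ψ : Fin m → Set (Matrix (Fin n) (Fin n) ℝ))
    (hne : ∀ j, (Ψ j).Nonempty)
    (hbdd : ∀ j, ∃ C : ℝ, ∀ B ∈ Ψ j, opNorm B ≤ C)
    (hpos : ∀ j, ∀ B ∈ Ψ j, ∀ x y, 0 ≤ B x y)
    (α : Fin m → ℝ) (hα : ∀ j, 0 < α j) (hαsum : ∑ j, α j = 1) :
    jointSpecRad (setHadWMean α Ψ) ≤ ∏ j, jointSpecRad (Ψ j) ^ (α j) := by
  have hfin : ∀ j, jointSpecRad (Ψ j) ≠ ∞ := fun j =>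
    (hbdd j).elim fun _ hC => jointSpecRad_ne_top hC
  unfold jointSpecRad at hfin ⊢
  simp only [← ENNReal.limsup_rpow _ (hα _)]
  refine le_trans (limsup_le_limsup (Eventually.of_forall fun k => ?_))
    (ENNReal.limsup_finset_prod_le Finset.univ fun j _ => ?_)
  · refine (ENNReal.rpow_le_rpow (iSup_setPow_setHadWMean_le hpos (fun j => (hα j).le) hαsum k)
      (by positivity)).trans (le_of_eq ?_)
    rw [← ENNReal.prod_rpow_of_nonneg (by positivity)]
    exact Finset.prod_congr rfl fun j _ => by
      rw [← ENNReal.rpow_mul, mul_comm, ENNReal.rpow_mul]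
  · rw [ENNReal.limsup_rpow _ (hα j)]
    exact ENNReal.rpow_ne_top_of_nonneg (hα j).le (hfin j)
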